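/- Let k be a field with char k = 3. The Lie algebra of k-linear derivations of the commutative k-algebra k[t]/(t³) is isomorphic as a Lie algebra to sl_2(k), the Lie algebra of 2×2 traceless matrices over k. -/

import Mathlib

open Polynomial

section SlToDerivation

variable {k A : Type*} [Field k] [CommRing A] [Algebra k A]

/-- The element `b + a t - c t²` of a `k`-algebra attached to the matrix `!![a, b; c, d]`. -/
def quadraticOfMatrix (t : A) : Matrix (Fin 2) (Fin 2) k →ₗ[k] A where
  toFun M := algebraMap k A (M 0 1) + algebraMap k A (M 0 0) * t - algebraMap k A (M 1 0) * t ^ 2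
  map_add' M N := by simp only [Matrix.add_apply, map_add]; ring
  map_smul' r M := by
    simp only [Matrix.smul_apply, smul_eq_mul, map_mul, RingHom.id_apply, Algebra.smul_def]
    ring

theorem quadraticOfMatrix_apply (t : A) (M : Matrix (Fin 2) (Fin 2) k) :
    quadraticOfMatrix t M =
      algebraMap k A (M 0 1) + algebraMap k A (M 0 0) * t - algebraMap k A (M 1 0) * t ^ 2 :=
  rfl

theorem sl_two_apply_one_one (M : LieAlgebra.SpecialLinear.sl (Fin 2) k) :
    M.val 1 1 = -M.val 0 0 := by
  have h : Matrix.trace M.val = 0 := M.property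
  rw [Matrix.trace_fin_two] at h
  linear_combination h

variable [CharP k 3] {t : A} {D : Derivation k A A}

/-- In characteristic `3`, if `D t = 1` and derivations are determined by their value
at `t`, then `!![a, b; c, -a] ↦ (b + a t - c t²) D` is a homomorphism of Lie algebras from `sl₂`. -/
def slToDerivation (hD : D t = 1)
    (hext : ∀ D₁ D₂ : Derivation k A A, D₁ t = D₂ t → D₁ = D₂) :
    LieAlgebra.SpecialLinear.sl (Fin 2) k →ₗ⁅k⁆ Derivation k A A where
  toFun M := quadraticOfMatrix t M.val • D
  map_add' M N := by
    rw [← add_smul, ← map_add]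
    rfl
  map_smul' r M := by
    rw [RingHom.id_apply, ← smul_assoc, ← map_smul]
    rfl
  map_lie' {M N} := by
    apply hext
    have h3 : (3 : A) = 0 := by
      have h : (3 : k) = 0 := by exact_mod_cast CharP.cast_eq_zero k 3
      rw [← map_ofNat (algebraMap k A) 3, h, map_zero]
    simp only [Derivation.commutator_apply, Derivation.smul_apply, hD, smul_eq_mul, mul_one,
      quadraticOfMatrix_apply, LieAlgebra.SpecialLinear.sl_bracket,
      Matrix.mul_apply, Fin.sum_univ_two, sl_two_apply_one_one, map_add, map_sub, map_mul, map_neg,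
      Derivation.leibniz, Derivation.map_algebraMap, Derivation.leibniz_pow, nsmul_eq_mul,
      Nat.cast_ofNat, mul_zero, add_zero, zero_add, Nat.add_one_sub_one, pow_one]
    generalize algebraMap k A (M.val 0 0) = a
    generalize algebraMap k A (M.val 0 1) = b
    generalize algebraMap k A (M.val 1 0) = c
    generalize algebraMap k A (N.val 0 0) = a'
    generalize algebraMap k A (N.val 0 1) = b'
    generalize algebraMap k A (N.val 1 0) = c'
    linear_combination
      (a * b' - b * a' + (b * c' - b' * c) * t + (a * c' - a' * c) * t ^ 2) * h3

theorem slToDerivation_apply (hD : D t = 1)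
    (hext : ∀ D₁ D₂ : Derivation k A A, D₁ t = D₂ t → D₁ = D₂)
    (M : LieAlgebra.SpecialLinear.sl (Fin 2) k) :
    slToDerivation hD hext M t = quadraticOfMatrix t M.val := by
  change quadraticOfMatrix t M.val • D t = _
  rw [hD, smul_eq_mul, mul_one]

theorem slToDerivation_bijective (hD : D t = 1)
    (hext : ∀ D₁ D₂ : Derivation k A A, D₁ t = D₂ t → D₁ = D₂)
    (hinj : ∀ a b c : k, algebraMap k A a + algebraMap k A b * t + algebraMap k A c * t ^ 2 = 0 →
      a = 0 ∧ b = 0 ∧ c = 0)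
    (hsurj : ∀ x : A, ∃ a b c : k,
      algebraMap k A a + algebraMap k A b * t + algebraMap k A c * t ^ 2 = x) :
    Function.Bijective (slToDerivation hD hext) := by
  constructor
  · rw [injective_iff_map_eq_zero]
    intro M hM
    have hq : quadraticOfMatrix t M.val = 0 := by
      rw [← slToDerivation_apply hD hext, hM, Derivation.zero_apply]
    obtain ⟨h01, h00, h10⟩ := hinj (M.val 0 1) (M.val 0 0) (-M.val 1 0) <| by
      rw [← hq, quadraticOfMatrix_apply, map_neg]
      ring
    have h11 := sl_two_apply_one_one M
    rw [h00, neg_zero] at h11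
    rw [neg_eq_zero] at h10
    ext i j
    fin_cases i <;> fin_cases j <;> assumption
  · intro E
    obtain ⟨a, b, c, h⟩ := hsurj (E t)
    have htr : Matrix.trace !![b, a; -c, -b] = 0 := by simp [Matrix.trace_fin_two]
    refine ⟨⟨!![b, a; -c, -b], htr⟩, hext _ _ ?_⟩
    rw [slToDerivation_apply, ← h, quadraticOfMatrix_apply]
    simp

end SlToDerivation

/-- Derivations of `R[X] ⧸ I` are determined by their value at the class of `X`. -/
theorem derivation_quotient_ext {R : Type*} [CommRing R] {I : Ideal R[X]}
    (D₁ D₂ : Derivation R (R[X] ⧸ I) (R[X] ⧸ I))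
    (h : D₁ (Ideal.Quotient.mk I X) = D₂ (Ideal.Quotient.mk I X)) : D₁ = D₂ := by
  ext a
  obtain ⟨p, rfl⟩ := Ideal.Quotient.mk_surjective a
  have hp : Ideal.Quotient.mk I p = aeval (Ideal.Quotient.mk I X) p := by
    rw [← Ideal.Quotient.mkₐ_eq_mk R I, aeval_algHom_apply, aeval_X_left_apply]
  rw [hp, Derivation.map_aeval, Derivation.map_aeval, h]

section TruncatedPolynomial

variable (k : Type*) [Field k]

theorem coeff_eq_zero_of_mk_quadratic_eq_zero {a b c : k}
    (h : Ideal.Quotient.mk (Ideal.span {(X : k[X]) ^ 3}) (C a + C b * X + C c * X ^ 2) = 0) :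
    a = 0 ∧ b = 0 ∧ c = 0 := by
  rw [Ideal.Quotient.eq_zero_iff_mem, Ideal.mem_span_singleton, X_pow_dvd_iff] at h
  have h0 := h 0 (by norm_num)
  have h1 := h 1 (by norm_num)
  have h2 := h 2 (by norm_num)
  simp [coeff_X, coeff_C, coeff_X_pow] at h0 h1 h2
  exact ⟨h0, h1, h2⟩

theorem exists_mk_quadratic_eq (x : k[X] ⧸ Ideal.span {(X : k[X]) ^ 3}) :
    ∃ a b c : k, Ideal.Quotient.mk _ (C a + C b * X + C c * X ^ 2) = x := by
  obtain ⟨p, rfl⟩ := Ideal.Quotient.mk_surjective x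
  refine ⟨p.coeff 0, p.coeff 1, p.coeff 2, ?_⟩
  rw [Ideal.Quotient.mk_eq_mk_iff_sub_mem, Ideal.mem_span_singleton, X_pow_dvd_iff]
  intro d hd
  interval_cases d <;> simp [coeff_X, coeff_C, coeff_X_pow]

theorem mkₐ_derivative_eq_zero [CharP k 3] (p : k[X])
    (hp : Ideal.Quotient.mkₐ k (Ideal.span {(X : k[X]) ^ 3}) p = 0) :
    Ideal.Quotient.mkₐ k (Ideal.span {(X : k[X]) ^ 3}) (derivative' p) = 0 := by
  rw [Ideal.Quotient.mkₐ_eq_mk, Ideal.Quotient.eq_zero_iff_mem, Ideal.mem_span_singleton] at hp ⊢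
  obtain ⟨q, rfl⟩ := hp
  have h3 : (3 : k) = 0 := by exact_mod_cast CharP.cast_eq_zero k 3
  refine ⟨derivative q, ?_⟩
  rw [derivative'_apply, derivative_mul, derivative_X_pow]
  simp only [Nat.cast_ofNat, h3, C_0, zero_mul, zero_add]

/-- In characteristic `3`, the derivation `d/dt` of `k[t]` descends to `k[t]/(t³)`. -/
theorem exists_derivation_mk_X_eq_one [CharP k 3] :
    ∃ D : Derivation k (k[X] ⧸ Ideal.span {(X : k[X]) ^ 3}) (k[X] ⧸ Ideal.span {(X : k[X]) ^ 3}),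
      D (Ideal.Quotient.mk _ X) = 1 := by
  have hsurj := Ideal.Quotient.mkₐ_surjective k (Ideal.span {(X : k[X]) ^ 3})
  have h := Derivation.liftOfSurjective_apply (d := derivative') hsurj (mkₐ_derivative_eq_zero k) X
  refine ⟨Derivation.liftOfSurjective (d := derivative') hsurj (mkₐ_derivative_eq_zero k),
    h.trans ?_⟩
  rw [derivative'_apply, derivative_X, map_one]

end TruncatedPolynomial

/-- Let `k` be a field of characteristic `3`.  The Lie algebra of
`k`-linear derivations of `k[t]/(t³)` is isomorphic to `sl₂(k)`, the Lie algebra of `2 × 2`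
traceless matrices over `k`. -/
theorem derivation_truncated_poly_iso_sl2 (k : Type) [Field k] [CharP k 3] :
    Nonempty
      ((Derivation k (Polynomial k ⧸ Ideal.span {(Polynomial.X : Polynomial k) ^ 3})
          (Polynomial k ⧸ Ideal.span {(Polynomial.X : Polynomial k) ^ 3}))
        ≃ₗ⁅k⁆ ↥(LieAlgebra.SpecialLinear.sl (Fin 2) k)) := by
  obtain ⟨D, hD⟩ := exists_derivation_mk_X_eq_one k
  refine ⟨(LieEquiv.ofBijective
    (slToDerivation hD derivation_quotient_ext)
    (slToDerivation_bijective hD derivation_quotient_ext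
      (fun a b c h => coeff_eq_zero_of_mk_quadratic_eq_zero k ?_)
      (fun x => ?_))).symm⟩
  · rw [← h]
    simp only [map_add, map_mul, map_pow]
    rfl
  · obtain ⟨a, b, c, h⟩ := exists_mk_quadratic_eq k x
    refine ⟨a, b, c, ?_⟩
    rw [← h]
    simp only [map_add, map_mul, map_pow]
    rfl
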